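/- Let 𝓕 ⊆ C([n],k) be a uniform set system (all members have the same cardinality k) with |𝓕| ≥ 2. Then 𝓕 is not s-extremal. -/

import Mathlib

open Finset

/-- The family of subsets of `[n]` (identified with `Fin n`) shattered by the
set system `F ⊆ 2^[n]`. -/
def Sh (n : ℕ) (F : Finset (Finset (Fin n))) : Finset (Finset (Fin n)) :=
  Finset.univ.filter (fun S => ∀ H ∈ S.powerset, ∃ A ∈ F, A ∩ S = H)

/-- A set system is shattering-extremal (s-extremal) if it shatters exactly
`|F|` sets. -/
def SExtremal (n : ℕ) (F : Finset (Finset (Fin n))) : Prop :=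
  (Sh n F).card = F.card

/-- The inclusion graph of a set system: vertices are the members of `F`,
two sets adjacent iff their symmetric difference is a single element. -/
def inclGraph (n : ℕ) (F : Finset (Finset (Fin n))) : SimpleGraph {A // A ∈ F} where
  Adj A B := (symmDiff A.1 B.1).card = 1
  symm := by constructor; intro A B h; rwa [symmDiff_comm]
  loopless := by constructor; intro A h; simp [symmDiff_self] at h

/-- `Sh n F` is the shatterer of `F`. -/
lemma Sh_eq_shatterer (n : ℕ) (F : Finset (Finset (Fin n))) : Sh n F = F.shatterer := by
  ext S
  simp [Sh, Finset.Shatters, inter_comm]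

/-- No member of the down-compression along `a` of a uniform family contains `a`. -/
lemma notMem_of_mem_compression_of_uniform {α : Type*} [DecidableEq α] {𝒜 : Finset (Finset α)}
    {k : ℕ} (h𝒜 : ∀ s ∈ 𝒜, s.card = k) {a : α} {s : Finset α}
    (hs : s ∈ Down.compression a 𝒜) : a ∉ s := by
  intro ha
  rcases Down.mem_compression.1 hs with ⟨h, h'⟩ | ⟨h, h'⟩
  · have := card_erase_lt_of_mem ha
    rw [h𝒜 _ h, h𝒜 _ h'] at this
    exact this.false
  · exact h (by rwa [insert_eq_self.2 ha] at h')

/-- A nontrivial uniform family shatters strictly more sets than it has members. -/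
lemma card_lt_card_shatterer_of_uniform {α : Type*} [DecidableEq α] {𝒜 : Finset (Finset α)}
    {k : ℕ} (h𝒜 : ∀ s ∈ 𝒜, s.card = k) (hcard : 1 < 𝒜.card) :
    𝒜.card < 𝒜.shatterer.card := by
  obtain ⟨s, hs, t, ht, hst⟩ := one_lt_card.1 hcard
  obtain ⟨a, has, hat⟩ : ∃ a ∈ s, a ∉ t := not_subset.1 fun h ↦
    hst (eq_of_subset_of_card_le h (by rw [h𝒜 s hs, h𝒜 t ht]))
  have mem : {a} ∈ 𝒜.shatterer := mem_shatterer.2 fun u hu ↦ by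
    rcases subset_singleton_iff.1 hu with rfl | rfl
    · exact ⟨t, ht, singleton_inter_of_notMem hat⟩
    · exact ⟨s, hs, singleton_inter_of_mem has⟩
  have notMem : {a} ∉ (Down.compression a 𝒜).shatterer := fun h ↦ by
    obtain ⟨u, hu, hau⟩ := (mem_shatterer.1 h).exists_superset
    exact notMem_of_mem_compression_of_uniform h𝒜 hu (singleton_subset_iff.1 hau)
  calc 𝒜.card = (Down.compression a 𝒜).card := (Down.card_compression a 𝒜).symm
    _ ≤ (Down.compression a 𝒜).shatterer.card := card_le_card_shatterer _
    _ < 𝒜.shatterer.card := card_lt_card <| Finset.ssubset_iff_subset_ne.2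
      ⟨shatterer_compress_subset_shatterer a 𝒜, fun h ↦ notMem (h ▸ mem)⟩

/-- A uniform set system with at least two members is not
s-extremal. -/
theorem stmt6 (n k : ℕ) (F : Finset (Finset (Fin n)))
    (huni : ∀ A ∈ F, A.card = k) (hcard : 2 ≤ F.card) :
    ¬ SExtremal n F := by
  rw [SExtremal, Sh_eq_shatterer]
  exact (card_lt_card_shatterer_of_uniform huni hcard).ne'
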